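/- Let ε ∈ ℝ and let u : ℝ → ℝ be four times continuously differentiable on [0,1] with u(0) = u''(0) = u(1) = u'(1) = 0, and set g(x) = u'''(x) + u(x)·u'(x) + ε·u''''(x) for x ∈ [0,1]. Then u'(0) + u''(1) − (1/2)∫₀¹ u(x)² dx − ε·u''(1) + ε·u'''(1) = ∫₀¹ x·g(x) dx. -/

import Mathlib

/-- Identity (3.47) in Estimate VII of the paper: multiplying the stationary equation
`u''' + u u' + ε u'''' = g` by `x` and integrating over `(0,1)`. Here `u₁, u₂, u₃, u₄`
are the first four derivatives of `u` on `[0,1]`. -/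
theorem estimateVII_identity_347 (ε : ℝ) (u u₁ u₂ u₃ u₄ : ℝ → ℝ)
    (hd1 : ∀ x ∈ Set.Icc (0 : ℝ) 1, HasDerivWithinAt u (u₁ x) (Set.Icc (0 : ℝ) 1) x)
    (hd2 : ∀ x ∈ Set.Icc (0 : ℝ) 1, HasDerivWithinAt u₁ (u₂ x) (Set.Icc (0 : ℝ) 1) x)
    (hd3 : ∀ x ∈ Set.Icc (0 : ℝ) 1, HasDerivWithinAt u₂ (u₃ x) (Set.Icc (0 : ℝ) 1) x)
    (hd4 : ∀ x ∈ Set.Icc (0 : ℝ) 1, HasDerivWithinAt u₃ (u₄ x) (Set.Icc (0 : ℝ) 1) x)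
    (hc : ContinuousOn u₄ (Set.Icc (0 : ℝ) 1))
    (hu0 : u 0 = 0) (hu2 : u₂ 0 = 0) (hu1 : u 1 = 0) (hux1 : u₁ 1 = 0)
    (g : ℝ → ℝ) (hg : ∀ x, g x = u₃ x + u x * u₁ x + ε * u₄ x) :
    u₁ 0 + u₂ 1 - (1 / 2) * (∫ x in (0 : ℝ)..1, (u x) ^ 2) - ε * u₂ 1 + ε * u₃ 1 =
      ∫ x in (0 : ℝ)..1, x * g x := by
  have c0 : ContinuousOn u (Set.Icc (0 : ℝ) 1) := fun x hx => (hd1 x hx).continuousWithinAt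
  have c1 : ContinuousOn u₁ (Set.Icc (0 : ℝ) 1) := fun x hx => (hd2 x hx).continuousWithinAt
  have c2 : ContinuousOn u₂ (Set.Icc (0 : ℝ) 1) := fun x hx => (hd3 x hx).continuousWithinAt
  have c3 : ContinuousOn u₃ (Set.Icc (0 : ℝ) 1) := fun x hx => (hd4 x hx).continuousWithinAt
  have hgc : ContinuousOn (fun x => x * g x) (Set.Icc (0 : ℝ) 1) := by
    simp only [hg]
    fun_prop
  have hsq : ContinuousOn (fun x => (1 / 2) * (u x) ^ 2) (Set.Icc (0 : ℝ) 1) := by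
    fun_prop
  have hgi : IntervalIntegrable (fun x => x * g x) MeasureTheory.volume 0 1 :=
    hgc.intervalIntegrable_of_Icc zero_le_one
  have hsi : IntervalIntegrable (fun x => (1 / 2) * (u x) ^ 2) MeasureTheory.volume 0 1 :=
    hsq.intervalIntegrable_of_Icc zero_le_one
  have key := intervalIntegral.integral_eq_sub_of_hasDerivAt_of_le (a := (0 : ℝ)) (b := 1)
    (f := fun x => x * u₂ x - u₁ x + (1 / 2) * (x * (u x) ^ 2) + ε * (x * u₃ x - u₂ x))
    (f' := fun x => x * g x + (1 / 2) * (u x) ^ 2) zero_le_one (by fun_prop)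
    (by
      intro x hx
      have hn : Set.Icc (0 : ℝ) 1 ∈ nhds x := Icc_mem_nhds hx.1 hx.2
      have hx' := Set.Ioo_subset_Icc_self hx
      have e1 := (hd1 x hx').hasDerivAt hn
      have e2 := (hd2 x hx').hasDerivAt hn
      have e3 := (hd3 x hx').hasDerivAt hn
      have e4 := (hd4 x hx').hasDerivAt hn
      have ei := hasDerivAt_id' x
      have := (((ei.mul e3).sub e2).add ((ei.mul (e1.pow 2)).const_mul (1 / 2))).add
        (((ei.mul e4).sub e3).const_mul ε)
      refine this.congr_deriv ?_
      simp only [hg, Pi.pow_apply]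
      push_cast
      ring)
    (hgi.add hsi)
  rw [intervalIntegral.integral_add hgi hsi, intervalIntegral.integral_const_mul] at key
  simp only [hu0, hu1, hu2, hux1] at key
  linarith
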